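/- Let 𝒯 be a triangulated category with a t-structure (𝒯^{≤0}, 𝒯^{≥0}), let 𝒩 ⊆ 𝒯 be a thick subcategory and Q : 𝒯 → 𝒯/𝒩 the Verdier quotient. Then (Q(𝒯^{≤0}), Q(𝒯^{≥0})) is a t-structure on 𝒯/𝒩 if and only if for every distinguished triangle X₁ → X₀ → N → ΣX₁ with X₁ ∈ 𝒯^{≥1}, X₀ ∈ 𝒯^{≤0}, and N ∈ 𝒩, one has X₁ ∈ 𝒩 and X₀ ∈ 𝒩. -/

import Mathlib

open CategoryTheory CategoryTheory.Limits CategoryTheory.Pretriangulated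

universe v u v₂ u₂

/-- A t-structure on a (pre)triangulated category, given by a pair of full replete
subcategories `(L, G)` (playing the roles of `𝒯^{≤0}` and `𝒯^{≥0}`) such that
`Hom(L, Σ⁻¹G) = 0`, `L` is stable under `Σ`, `G` is stable under `Σ⁻¹`, and every
object fits in a distinguished triangle `X ⟶ C ⟶ Σ⁻¹Y ⟶ ΣX` with `X ∈ L`, `Y ∈ G`. -/
structure IsTStructure (T : Type u) [Category.{v} T] [HasZeroObject T] [HasShift T ℤ]
    [Preadditive T] [∀ n : ℤ, (shiftFunctor T n).Additive] [Pretriangulated T]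
    (L G : T → Prop) : Prop where
  replete_le : ∀ {X Y : T}, (X ≅ Y) → L X → L Y
  replete_ge : ∀ {X Y : T}, (X ≅ Y) → G X → G Y
  hom_zero : ∀ {X Y : T}, L X → G Y → ∀ f : X ⟶ (shiftFunctor T (-1 : ℤ)).obj Y, f = 0
  shift_le : ∀ {X : T}, L X → L ((shiftFunctor T (1 : ℤ)).obj X)
  shift_ge : ∀ {Y : T}, G Y → G ((shiftFunctor T (-1 : ℤ)).obj Y)
  exists_triangle : ∀ Z : T, ∃ (X Y : T) (f : X ⟶ Z)
    (g : Z ⟶ (shiftFunctor T (-1 : ℤ)).obj Y)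
    (h : (shiftFunctor T (-1 : ℤ)).obj Y ⟶ (shiftFunctor T (1 : ℤ)).obj X),
    L X ∧ G Y ∧ Triangle.mk f g h ∈ distTriang T

/-- A thick triangulated subcategory: contains a zero object, is replete, stable under
all shifts, closed under extensions (two-out-of-three in distinguished triangles), and
closed under retracts (direct summands). -/
structure IsThickSub (T : Type u) [Category.{v} T] [HasZeroObject T] [HasShift T ℤ]
    [Preadditive T] [∀ n : ℤ, (shiftFunctor T n).Additive] [Pretriangulated T]
    (N : T → Prop) : Prop where
  zero : ∃ Z : T, IsZero Z ∧ N Z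
  replete : ∀ {X Y : T}, (X ≅ Y) → N X → N Y
  shift : ∀ {X : T} (n : ℤ), N X → N ((shiftFunctor T n).obj X)
  ext₂ : ∀ (Tr : Triangle T), Tr ∈ (distTriang T) → N Tr.obj₁ → N Tr.obj₃ → N Tr.obj₂
  retract : ∀ {X Y : T}, N Y → ∀ (i : X ⟶ Y) (r : Y ⟶ X), i ≫ r = 𝟙 X → N X

/-- The class of morphisms whose cone lies in `N`; the Verdier quotient `𝒯/𝒩` is the
localization at this class. -/
def coneIn (T : Type u) [Category.{v} T] [HasZeroObject T] [HasShift T ℤ]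
    [Preadditive T] [∀ n : ℤ, (shiftFunctor T n).Additive] [Pretriangulated T]
    (N : T → Prop) : MorphismProperty T :=
  fun X Y f => ∃ (Z : T) (g : Y ⟶ Z) (h : Z ⟶ (shiftFunctor T (1 : ℤ)).obj X),
    N Z ∧ Triangle.mk f g h ∈ distTriang T

section helpers

variable {T : Type u} [Category.{v} T] [HasZeroObject T] [HasShift T ℤ]
    [Preadditive T] [∀ n : ℤ, (shiftFunctor T n).Additive] [Pretriangulated T]

section wrappers

variable {X Y Z A : T} {f : X ⟶ Y} {g : Y ⟶ Z} {h : Z ⟶ X⟦(1 : ℤ)⟧}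

lemma yo2 (H : Triangle.mk f g h ∈ distTriang T) (φ : Y ⟶ A) (hφ : f ≫ φ = 0) :
    ∃ ψ : Z ⟶ A, φ = g ≫ ψ := Triangle.yoneda_exact₂ _ H φ hφ

lemma yo3 (H : Triangle.mk f g h ∈ distTriang T) (φ : Z ⟶ A) (hφ : g ≫ φ = 0) :
    ∃ ψ : X⟦(1 : ℤ)⟧ ⟶ A, φ = h ≫ ψ := Triangle.yoneda_exact₃ _ H φ hφ

lemma co2 (H : Triangle.mk f g h ∈ distTriang T) (φ : A ⟶ Y) (hφ : φ ≫ g = 0) :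
    ∃ ψ : A ⟶ X, φ = ψ ≫ f := Triangle.coyoneda_exact₂ _ H φ hφ

lemma co3 (H : Triangle.mk f g h ∈ distTriang T) (φ : A ⟶ Z) (hφ : φ ≫ h = 0) :
    ∃ ψ : A ⟶ Y, φ = ψ ≫ g := Triangle.coyoneda_exact₃ _ H φ hφ

lemma rot_mk (H : Triangle.mk f g h ∈ distTriang T) :
    Triangle.mk g h (-f⟦(1 : ℤ)⟧') ∈ distTriang T := rot_of_distTriang _ H

lemma yo1 (H : Triangle.mk f g h ∈ distTriang T) (φ : X⟦(1 : ℤ)⟧ ⟶ A) (hφ : h ≫ φ = 0) :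
    ∃ ψ : Y⟦(1 : ℤ)⟧ ⟶ A, φ = f⟦(1 : ℤ)⟧' ≫ ψ := by
  obtain ⟨ψ, hψ⟩ := yo3 (rot_mk H) φ hφ
  exact ⟨-ψ, by rw [hψ]; simp⟩

lemma yo2' (H : Triangle.mk f g h ∈ distTriang T) (φ : Y⟦(1 : ℤ)⟧ ⟶ A)
    (hφ : f⟦(1 : ℤ)⟧' ≫ φ = 0) :
    ∃ ψ : Z⟦(1 : ℤ)⟧ ⟶ A, φ = g⟦(1 : ℤ)⟧' ≫ ψ :=
  yo1 (rot_mk H) φ (by rw [Preadditive.neg_comp, hφ, neg_zero])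

lemma sq2 {X' Y' Z' : T} {f' : X' ⟶ Y'} {g' : Y' ⟶ Z'} {h' : Z' ⟶ X'⟦(1 : ℤ)⟧}
    (H : Triangle.mk f g h ∈ distTriang T) (H' : Triangle.mk f' g' h' ∈ distTriang T)
    (a : X ⟶ X') (c : Z ⟶ Z') (e : h ≫ a⟦(1 : ℤ)⟧' = c ≫ h') :
    ∃ r : Y ⟶ Y', f ≫ r = a ≫ f' ∧ g ≫ c = r ≫ g' :=
  complete_distinguished_triangle_morphism₂ _ _ H H' a c e

lemma sq1 {X' Y' Z' : T} {f' : X' ⟶ Y'} {g' : Y' ⟶ Z'} {h' : Z' ⟶ X'⟦(1 : ℤ)⟧}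
    (H : Triangle.mk f g h ∈ distTriang T) (H' : Triangle.mk f' g' h' ∈ distTriang T)
    (b : Y ⟶ Y') (c : Z ⟶ Z') (e : g ≫ c = b ≫ g') :
    ∃ r : X ⟶ X', f ≫ b = r ≫ f' := by
  obtain ⟨r, hr, _⟩ := complete_distinguished_triangle_morphism₁ _ _ H H' b c e
  exact ⟨r, hr⟩

lemma dist_of_isos {Y' Z' : T} (H : Triangle.mk f g h ∈ distTriang T) (e : Y ≅ Y') (i : Z ≅ Z') :
    Triangle.mk (f ≫ e.hom) (e.inv ≫ g ≫ i.hom) (i.inv ≫ h) ∈ distTriang T := by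
  refine isomorphic_distinguished _ H _ ?_
  refine Triangle.isoMk (Triangle.mk _ _ _) (Triangle.mk _ _ _) (Iso.refl X) e.symm i.symm ?_ ?_ ?_
  · change (f ≫ e.hom) ≫ e.inv = 𝟙 X ≫ f
    simp
  · change (e.inv ≫ g ≫ i.hom) ≫ i.inv = e.inv ≫ g
    simp
  · change (i.inv ≫ h) ≫ (𝟙 X)⟦(1 : ℤ)⟧' = i.inv ≫ h
    simp

end wrappers

/-- Morphisms which factor through an object of `N`. -/
def FactorsN (N : T → Prop) {X Y : T} (f : X ⟶ Y) : Prop :=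
  ∃ (M : T) (v : X ⟶ M) (w : M ⟶ Y), N M ∧ v ≫ w = f

lemma coneIn_iff' {N : T → Prop} (hN : IsThickSub T N) {Y Z : T} (g : Y ⟶ Z) (hg : coneIn T N g) :
    ∃ (X : T) (f : X ⟶ Y) (h : Z ⟶ X⟦(1 : ℤ)⟧), N X ∧ Triangle.mk f g h ∈ distTriang T := by
  obtain ⟨Z, g, h, hZ, H⟩ := hg
  exact ⟨_, _, _, hN.shift (-1) hZ, inv_rot_of_distTriang _ H⟩

lemma coneIn_of_fiber {N : T → Prop} (hN : IsThickSub T N) {X Y Z : T} {f : X ⟶ Y} {g : Y ⟶ Z}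
    {h : Z ⟶ X⟦(1 : ℤ)⟧} (H : Triangle.mk f g h ∈ distTriang T) (hX : N X) : coneIn T N g :=
  ⟨_, _, _, hN.shift 1 hX, rot_of_distTriang _ H⟩

lemma N_of_factors {N : T → Prop} (hN : IsThickSub T N) {X : T} (h : FactorsN N (𝟙 X)) : N X := by
  obtain ⟨M, v, w, hM, e⟩ := h
  exact hN.retract hM v w e

lemma factors_of_precomp {N : T → Prop} (hN : IsThickSub T N) {X Y Z : T} (w : X ⟶ Y)
    (hw : coneIn T N w) (h : Y ⟶ Z) (hf : FactorsN N (w ≫ h)) : FactorsN N h := by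
  obtain ⟨K, p, δ, hK, H⟩ := hw
  obtain ⟨M, a, b, hM, e⟩ := hf
  obtain ⟨P, j, q, HP⟩ := distinguished_cocone_triangle₂ (δ ≫ a⟦(1 : ℤ)⟧')
  have hP : N P := hN.ext₂ _ HP hM hK
  obtain ⟨r, hr₁, hr₂⟩ := sq2 H HP a (𝟙 K) (by simp)
  have hr₁' : w ≫ r = a ≫ j := hr₁
  have hr₂' : p = r ≫ q := by simpa using hr₂
  have z : w⟦(1 : ℤ)⟧' ≫ h⟦(1 : ℤ)⟧' = a⟦(1 : ℤ)⟧' ≫ b⟦(1 : ℤ)⟧' := by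
    rw [← Functor.map_comp, ← Functor.map_comp, e]
  have z₀ : δ ≫ w⟦(1 : ℤ)⟧' = 0 := comp_distTriang_mor_zero₃₁ _ H
  have z₂ : (δ ≫ a⟦(1 : ℤ)⟧') ≫ b⟦(1 : ℤ)⟧' = 0 := by
    rw [Category.assoc, ← z, ← Category.assoc, z₀, zero_comp]
  obtain ⟨i, hi⟩ : ∃ i : P ⟶ Z, j ≫ i = b := by
    obtain ⟨i, hi⟩ := yo1 HP (b⟦(1 : ℤ)⟧') z₂
    obtain ⟨i', rfl⟩ := (shiftFunctor T (1 : ℤ)).map_surjective i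
    refine ⟨i', (shiftFunctor T (1 : ℤ)).map_injective ?_⟩
    rw [hi, Functor.map_comp]
  have z₃ : w ≫ (r ≫ i - h) = 0 := by
    rw [Preadditive.comp_sub, ← Category.assoc, hr₁', Category.assoc, hi, e, sub_self]
  obtain ⟨k, hk⟩ := yo2 H _ z₃
  have hk' : r ≫ i - h = p ≫ k := hk
  refine ⟨P, r, i - q ≫ k, hP, ?_⟩
  rw [Preadditive.comp_sub, ← Category.assoc r q, ← hr₂', ← hk']
  abel

lemma factors_of_postcomp {N : T → Prop} (hN : IsThickSub T N) {A X Y : T} (w : X ⟶ Y)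
    (hw : coneIn T N w) (h : A ⟶ X) (hf : FactorsN N (h ≫ w)) : FactorsN N h := by
  obtain ⟨K, k, δ, hK, H⟩ := coneIn_iff' hN w hw
  obtain ⟨M, a, b, hM, e⟩ := hf
  obtain ⟨P, j, q, HP⟩ := distinguished_cocone_triangle₂ (b ≫ δ)
  have hP : N P := hN.ext₂ _ HP hK hM
  obtain ⟨r, hr₁, hr₂⟩ := sq2 HP H (𝟙 K) b (by simp)
  have hr₁' : j ≫ r = k := by simpa using hr₁
  have hr₂' : q ≫ b = r ≫ w := hr₂
  have z₀ : w ≫ δ = 0 := comp_distTriang_mor_zero₂₃ _ H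
  have z₂ : a ≫ b ≫ δ = 0 := by
    rw [← Category.assoc, e, Category.assoc, z₀, comp_zero]
  obtain ⟨i, hi⟩ := co3 HP a z₂
  have hi' : a = i ≫ q := hi
  have z₃ : (i ≫ r - h) ≫ w = 0 := by
    rw [Preadditive.sub_comp, Category.assoc, ← hr₂', ← Category.assoc, ← hi', e, sub_self]
  obtain ⟨l, hl⟩ := co2 H _ z₃
  have hl' : i ≫ r - h = l ≫ k := hl
  refine ⟨P, i - l ≫ j, r, hP, ?_⟩
  rw [Preadditive.sub_comp, Category.assoc, hr₁', ← hl']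
  abel

lemma factors_zero {N : T → Prop} (hN : IsThickSub T N) (X Y : T) : FactorsN N (0 : X ⟶ Y) := by
  obtain ⟨Z, _, hZ⟩ := hN.zero
  exact ⟨Z, 0, 0, hZ, by simp⟩

lemma coneIn_shift {N : T → Prop} (hN : IsThickSub T N) {X Y : T} (f : X ⟶ Y)
    (hf : coneIn T N f) : coneIn T N (f⟦(1 : ℤ)⟧') := by
  obtain ⟨Z, g, h, hZ, H⟩ := hf
  have H' := rot_mk (rot_mk (rot_mk H))
  refine ⟨Z⟦(1 : ℤ)⟧, -g⟦(1 : ℤ)⟧', h⟦(1 : ℤ)⟧', hN.shift 1 hZ, ?_⟩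
  refine isomorphic_distinguished _ H' _ ?_
  refine Triangle.isoMk (Triangle.mk _ _ _) (Triangle.mk _ _ _) (-(Iso.refl (X⟦(1 : ℤ)⟧)))
    (Iso.refl (Y⟦(1 : ℤ)⟧)) (Iso.refl (Z⟦(1 : ℤ)⟧)) ?_ ?_ ?_
  · change f⟦(1 : ℤ)⟧' ≫ 𝟙 _ = (-𝟙 (X⟦(1 : ℤ)⟧)) ≫ (-f⟦(1 : ℤ)⟧')
    simp
  · change (-g⟦(1 : ℤ)⟧') ≫ 𝟙 _ = 𝟙 (Y⟦(1 : ℤ)⟧) ≫ (-g⟦(1 : ℤ)⟧')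
    simp
  · change h⟦(1 : ℤ)⟧' ≫ (-𝟙 (X⟦(1 : ℤ)⟧))⟦(1 : ℤ)⟧' = 𝟙 (Z⟦(1 : ℤ)⟧) ≫ (-h⟦(1 : ℤ)⟧')
    simp

lemma coneIn_comp {N : T → Prop} (hN : IsThickSub T N) {X Y Z : T} (f : X ⟶ Y) (g : Y ⟶ Z)
    (hf : coneIn T N f) (hg : coneIn T N g) : coneIn T N (f ≫ g) := by
  obtain ⟨E, ι, d, H⟩ := distinguished_cocone_triangle (f ≫ g)
  refine ⟨E, ι, d, ?_, H⟩
  have h₁ : FactorsN N ι := by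
    apply factors_of_precomp hN g hg
    apply factors_of_precomp hN f hf
    have z : (f ≫ g) ≫ ι = 0 := comp_distTriang_mor_zero₁₂ _ H
    rw [← Category.assoc, z]
    exact factors_zero hN _ _
  have h₂ : FactorsN N d := by
    apply factors_of_postcomp hN (f⟦(1 : ℤ)⟧') (coneIn_shift hN f hf)
    apply factors_of_postcomp hN (g⟦(1 : ℤ)⟧') (coneIn_shift hN g hg)
    have z : d ≫ (f ≫ g)⟦(1 : ℤ)⟧' = 0 := comp_distTriang_mor_zero₃₁ _ H
    rw [Category.assoc, ← Functor.map_comp, z]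
    exact factors_zero hN _ _
  obtain ⟨M, a, b, hM, e⟩ := h₂
  obtain ⟨E', s, t, Hs⟩ := distinguished_cocone_triangle₁ a
  have hs : coneIn T N s := ⟨M, a, t, hM, Hs⟩
  have z : s ≫ d = 0 := by
    have z' : s ≫ a = 0 := comp_distTriang_mor_zero₁₂ _ Hs
    rw [← e, ← Category.assoc, z', zero_comp]
  obtain ⟨l, hl⟩ := co3 H s z
  have hl' : s = l ≫ ι := hl
  apply N_of_factors hN
  apply factors_of_precomp hN s hs
  obtain ⟨M', a', b', hM', e'⟩ := h₁
  exact ⟨M', l ≫ a', b', hM', by rw [Category.assoc, e', ← hl', Category.comp_id]⟩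

lemma coneIn_rightCalculus {N : T → Prop} (hN : IsThickSub T N) :
    (coneIn T N).HasRightCalculusOfFractions where
  id_mem X := by
    obtain ⟨Z, hZ, hNZ⟩ := hN.zero
    exact ⟨_, _, _, hN.replete (hZ.iso (isZero_zero T)) hNZ, contractible_distinguished X⟩
  comp_mem f g hf hg := coneIn_comp hN f g hf hg
  exists_rightFraction X Y φ := by
    obtain ⟨Z, f, g, mem, H⟩ := φ.hs
    obtain ⟨X', f', h', mem'⟩ := distinguished_cocone_triangle₁ (φ.f ≫ f)
    obtain ⟨a, ha₁⟩ := sq1 mem' H φ.f (𝟙 Z) (by simp)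
    exact ⟨MorphismProperty.RightFraction.mk f' ⟨_, _, _, mem, mem'⟩ a, ha₁⟩
  ext Y Z Z' f₁ f₂ s hs hf₁ := by
    obtain ⟨Z, g, h, mem, H⟩ := coneIn_iff' hN s hs
    have hf₂ : (f₁ - f₂) ≫ s = 0 := by rw [Preadditive.sub_comp, hf₁, sub_self]
    obtain ⟨q, hq⟩ := co2 H _ hf₂
    obtain ⟨Y', r, t, mem'⟩ := distinguished_cocone_triangle₁ q
    refine ⟨Y', r, ⟨_, _, _, mem, mem'⟩, ?_⟩
    have eq : r ≫ q = 0 := comp_distTriang_mor_zero₁₂ _ mem'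
    rw [← sub_eq_zero, ← Preadditive.comp_sub, hq, ← Category.assoc, eq, zero_comp]

lemma ts_hom_zero {L G : T → Prop} (hTS : IsTStructure T L G) {X Z : T} (hX : L X)
    (hZ : G (Z⟦(1 : ℤ)⟧)) (f : X ⟶ Z) : f = 0 := by
  let e : Z ≅ (Z⟦(1 : ℤ)⟧)⟦(-1 : ℤ)⟧ := (shiftEquiv T (1 : ℤ)).unitIso.app Z
  have := hTS.hom_zero hX hZ (f ≫ e.hom)
  rw [← cancel_mono e.hom, this, zero_comp]

lemma ts_ge {L G : T → Prop} (hTS : IsTStructure T L G) {Y : T} (hY : G Y) :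
    G ((Y⟦(-1 : ℤ)⟧)⟦(1 : ℤ)⟧) :=
  hTS.replete_ge ((shiftEquiv T (1 : ℤ)).counitIso.symm.app Y) hY

lemma ts_le_of_hom {L G : T → Prop} (hTS : IsTStructure T L G) {C : T}
    (h : ∀ (Z : T), G (Z⟦(1 : ℤ)⟧) → ∀ f : C ⟶ Z, f = 0) : L C := by
  obtain ⟨X, Y, f, g, d, hX, hY, H⟩ := hTS.exists_triangle C
  have hg : g = 0 := h _ (ts_ge hTS hY) g
  obtain ⟨r, hr⟩ := yo3 H (𝟙 (Y⟦(-1 : ℤ)⟧)) (by simpa using hg)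
  have hr0 : r = 0 := ts_hom_zero hTS (hTS.shift_le hX) (ts_ge hTS hY) r
  have hz : IsZero (Y⟦(-1 : ℤ)⟧) := by
    rw [IsZero.iff_id_eq_zero]
    exact hr.trans (by rw [hr0, comp_zero])
  have : IsIso f := (Triangle.isZero₃_iff_isIso₁ _ H).1 hz
  exact hTS.replete_le (asIso f) hX

/-- The truncation of a morphism `X₁ ⟶ X` with cone in `N` and `X ∈ L`. -/
lemma exists_le {L G N : T → Prop} (hTS : IsTStructure T L G)
    (hR : ∀ (X₁ X₀ N₀ : T) (a : X₁ ⟶ X₀) (b : X₀ ⟶ N₀)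
          (c : N₀ ⟶ (shiftFunctor T (1 : ℤ)).obj X₁),
        Triangle.mk a b c ∈ (distTriang T) →
        G ((shiftFunctor T (1 : ℤ)).obj X₁) → L X₀ → N N₀ → N X₁ ∧ N X₀)
    {X₁ X : T} (s : X₁ ⟶ X) (hs : coneIn T N s) (hX : L X) :
    ∃ (A : T) (f : A ⟶ X₁), L A ∧ coneIn T N f := by
  obtain ⟨N₁, p, δ, hN₁, H⟩ := hs
  obtain ⟨A, Y, f, g, h, hA, hY, H₁⟩ := hTS.exists_triangle X₁
  refine ⟨A, f, hA, _, g, h, ?_, H₁⟩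
  obtain ⟨C, β, γ, HC⟩ := distinguished_cocone_triangle₂ (δ ≫ g⟦(1 : ℤ)⟧')
  refine (hR _ _ _ β γ _ HC (ts_ge hTS hY) ?_ hN₁).1
  apply ts_le_of_hom hTS
  intro Z hZ φ
  have h0 : g ≫ β ≫ φ = 0 := by
    have z : δ ≫ (g ≫ β ≫ φ)⟦(1 : ℤ)⟧' = 0 := by
      have z' : (δ ≫ g⟦(1 : ℤ)⟧') ≫ β⟦(1 : ℤ)⟧' = 0 := comp_distTriang_mor_zero₃₁ _ HC
      rw [Functor.map_comp, Functor.map_comp, ← Category.assoc, ← Category.assoc, z', zero_comp]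
    obtain ⟨e, he⟩ := yo1 H _ z
    obtain ⟨e', rfl⟩ := (shiftFunctor T (1 : ℤ)).map_surjective e
    have he' : e' = 0 := ts_hom_zero hTS hX hZ e'
    apply (shiftFunctor T (1 : ℤ)).map_injective
    rw [he, he', Functor.map_zero, Functor.map_zero, comp_zero]
  have h1 : β ≫ φ = 0 := by
    obtain ⟨k, hk⟩ := yo3 H₁ _ h0
    have : k = 0 := ts_hom_zero hTS (hTS.shift_le hA) hZ k
    rw [hk, this, comp_zero]
  obtain ⟨m, hm⟩ := yo2 HC _ h1
  have hm' : φ = γ ≫ m := hm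
  have h2 : p ≫ m = 0 := ts_hom_zero hTS hX hZ _
  obtain ⟨m', h3⟩ := yo3 H _ h2
  have h3' : m = δ ≫ m' := h3
  have h4 : f⟦(1 : ℤ)⟧' ≫ m' = 0 := ts_hom_zero hTS (hTS.shift_le hA) hZ _
  obtain ⟨m'', h5⟩ := yo2' H₁ m' h4
  have h5' : m' = g⟦(1 : ℤ)⟧' ≫ m'' := h5
  have z : γ ≫ δ ≫ g⟦(1 : ℤ)⟧' = 0 := comp_distTriang_mor_zero₂₃ _ HC
  have z' : γ ≫ δ ≫ g⟦(1 : ℤ)⟧' ≫ m'' = (γ ≫ δ ≫ g⟦(1 : ℤ)⟧') ≫ m'' := by simp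
  rw [hm', h3', h5', z', z, zero_comp]

end helpers

/-- Let `(𝒯^{≤0}, 𝒯^{≥0})` be a t-structure on a triangulated category 𝒯, `𝒩 ⊆ 𝒯` a thick
subcategory, and `Q : 𝒯 ⥤ 𝒯/𝒩` the Verdier quotient (a triangulated localization at the
morphisms with cone in 𝒩).  Then the pair of images `(Q(𝒯^{≤0}), Q(𝒯^{≥0}))` is a
t-structure on `𝒯/𝒩` if and only if for every distinguished triangle
`X₁ ⟶ X₀ ⟶ N ⟶ ΣX₁` with `X₁ ∈ 𝒯^{≥1}`, `X₀ ∈ 𝒯^{≤0}` and `N ∈ 𝒩`, both `X₁` and `X₀`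
lie in 𝒩. -/
theorem tStructure_descends_iff
    {T : Type u} [Category.{v} T] [HasZeroObject T] [HasShift T ℤ]
    [Preadditive T] [∀ n : ℤ, (shiftFunctor T n).Additive] [Pretriangulated T]
    {D : Type u₂} [Category.{v₂} D] [HasZeroObject D] [HasShift D ℤ]
    [Preadditive D] [∀ n : ℤ, (shiftFunctor D n).Additive] [Pretriangulated D]
    (L G N : T → Prop) (hTS : IsTStructure T L G) (hN : IsThickSub T N)
    (Q : T ⥤ D) [Q.CommShift ℤ] [Q.IsTriangulated] [Q.IsLocalization (coneIn T N)] :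
    IsTStructure D (fun Z => ∃ X : T, L X ∧ Nonempty (Q.obj X ≅ Z))
        (fun Z => ∃ Y : T, G Y ∧ Nonempty (Q.obj Y ≅ Z)) ↔
      (∀ (X₁ X₀ N₀ : T) (a : X₁ ⟶ X₀) (b : X₀ ⟶ N₀)
          (c : N₀ ⟶ (shiftFunctor T (1 : ℤ)).obj X₁),
        Triangle.mk a b c ∈ (distTriang T) →
        G ((shiftFunctor T (1 : ℤ)).obj X₁) → L X₀ → N N₀ → N X₁ ∧ N X₀) := by
  have hcalc := coneIn_rightCalculus hN
  have hinv : ∀ {X Y : T} (s : X ⟶ Y), coneIn T N s → IsIso (Q.map s) :=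
    fun s hs => Localization.inverts Q (coneIn T N) s hs
  constructor
  · intro hD X₁ X₀ N₀ a b c H hX₁ hX₀ hN₀
    have hker : ∀ X : T, IsZero (Q.obj X) → N X := by
      intro X hX
      have hz : Q.map (𝟙 X) = Q.map 0 := hX.eq_of_src _ _
      obtain ⟨X', s, hs, e⟩ := (MorphismProperty.map_eq_iff_precomp Q (coneIn T N) _ _).1 hz
      apply N_of_factors hN
      apply factors_of_precomp hN s hs
      rw [e, comp_zero]
      exact factors_zero hN _ _
    have : IsIso (Q.map a) := hinv a ⟨_, b, c, hN₀, H⟩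
    have h0 := ts_hom_zero hD (X := Q.obj X₀) (Z := Q.obj X₁) ⟨X₀, hX₀, ⟨Iso.refl _⟩⟩
      ⟨_, hX₁, ⟨(Q.commShiftIso (1 : ℤ)).app X₁⟩⟩ (inv (Q.map a))
    have hz₁ : IsZero (Q.obj X₁) := by
      rw [IsZero.iff_id_eq_zero, ← IsIso.hom_inv_id (Q.map a), h0, comp_zero]
    exact ⟨hker _ hz₁, hker _ (hz₁.of_iso (asIso (Q.map a)).symm)⟩
  · intro hR
    have key : ∀ {X Z : T} (_ : L X) (_ : G (Z⟦(1 : ℤ)⟧)) (f : Q.obj X ⟶ Q.obj Z), f = 0 := by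
      intro X Z hX hZ f
      obtain ⟨φ, rfl⟩ := Localization.exists_rightFraction Q (coneIn T N) f
      have := hinv φ.s φ.hs
      obtain ⟨A, g, hA, hg⟩ := exists_le hTS hR φ.s φ.hs hX
      have := hinv g hg
      have h0 : g ≫ φ.f = 0 := ts_hom_zero hTS hA hZ _
      have h1 : Q.map φ.f = 0 := by
        rw [← cancel_epi (Q.map g), ← Q.map_comp, h0, Q.map_zero, comp_zero]
      rw [← cancel_epi (Q.map φ.s), MorphismProperty.RightFraction.map_s_comp_map, h1, comp_zero]
    refine ⟨?_, ?_, ?_, ?_, ?_, ?_⟩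
    · rintro X Y e ⟨X', hX', ⟨e'⟩⟩
      exact ⟨X', hX', ⟨e' ≪≫ e⟩⟩
    · rintro X Y e ⟨X', hX', ⟨e'⟩⟩
      exact ⟨X', hX', ⟨e' ≪≫ e⟩⟩
    · rintro X Y ⟨X', hX', ⟨e⟩⟩ ⟨Y', hY', ⟨e'⟩⟩ f
      let i : Q.obj (Y'⟦(-1 : ℤ)⟧) ≅ Y⟦(-1 : ℤ)⟧ :=
        (Q.commShiftIso (-1 : ℤ)).app Y' ≪≫ (shiftFunctor D (-1 : ℤ)).mapIso e'
      have := key hX' (ts_ge hTS hY') (e.hom ≫ f ≫ i.inv)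
      rw [← cancel_epi e.hom, ← cancel_mono i.inv, Category.assoc, this]
      simp
    · rintro X ⟨X', hX', ⟨e⟩⟩
      exact ⟨_, hTS.shift_le hX',
        ⟨(Q.commShiftIso (1 : ℤ)).app X' ≪≫ (shiftFunctor D (1 : ℤ)).mapIso e⟩⟩
    · rintro X ⟨X', hX', ⟨e⟩⟩
      exact ⟨_, hTS.shift_ge hX',
        ⟨(Q.commShiftIso (-1 : ℤ)).app X' ≪≫ (shiftFunctor D (-1 : ℤ)).mapIso e⟩⟩
    · intro Z
      have := Localization.essSurj Q (coneIn T N)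
      let e := Q.objObjPreimageIso Z
      obtain ⟨X, Y, f, g, h, hX, hY, H⟩ := hTS.exists_triangle (Q.objPreimage Z)
      have H' : Triangle.mk (Q.map f) (Q.map g) (Q.map h ≫ (Q.commShiftIso (1 : ℤ)).hom.app X) ∈
          distTriang D := Q.map_distinguished _ H
      let i : Q.obj (Y⟦(-1 : ℤ)⟧) ≅ (Q.obj Y)⟦(-1 : ℤ)⟧ := (Q.commShiftIso (-1 : ℤ)).app Y
      refine ⟨Q.obj X, Q.obj Y, Q.map f ≫ e.hom, e.inv ≫ Q.map g ≫ i.hom,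
        i.inv ≫ Q.map h ≫ (Q.commShiftIso (1 : ℤ)).hom.app X,
        ⟨X, hX, ⟨Iso.refl _⟩⟩, ⟨Y, hY, ⟨Iso.refl _⟩⟩, ?_⟩
      exact dist_of_isos H' e i
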